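/- Let n ≥ 1, Q = 4n+6, 2* = 2Q/(Q−2), K = (Q−2)(Q−6)/8 = 2n(n+1), and Φ(q,ω) = 8^{n+1}[(1+|q|²)² + |ω|²]^{−(n+1)}. Then for every smooth bounded function G: ℝ^{4n+3} → ℝ with bounded horizontal gradient, the Dirichlet energy of GΦ satisfies the identity ∫_{ℝ^{4n+3}} |∇(GΦ)|² dH = ∫_{ℝ^{4n+3}} ( Φ² |∇G|² + K G² Φ^{2*} ) dH, all integrals being finite. -/

import Mathlib

open MeasureTheory Real

/-- The quaternionic Heisenberg group `G(ℍ) = ℍⁿ × Im ℍ`, identified with `ℝ^{4n+3}`: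
a point is `(q, ω)` where `q α = (t_α, x_α, y_α, z_α)` are the coordinates of the
quaternion `q_α = t_α + i x_α + j y_α + k z_α`, and `ω = (x, y, z)` are the coordinates
of `ω = ix + jy + kz ∈ Im ℍ`. -/
abbrev QH (n : ℕ) : Type := (Fin n → ℝ × ℝ × ℝ × ℝ) × (ℝ × ℝ × ℝ)

namespace QH

/-- `t`-coordinate of a quaternion quadruple. -/
def tC (a : ℝ × ℝ × ℝ × ℝ) : ℝ := a.1
/-- `x`-coordinate of a quaternion quadruple. -/
def xC (a : ℝ × ℝ × ℝ × ℝ) : ℝ := a.2.1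
/-- `y`-coordinate of a quaternion quadruple. -/
def yC (a : ℝ × ℝ × ℝ × ℝ) : ℝ := a.2.2.1
/-- `z`-coordinate of a quaternion quadruple. -/
def zC (a : ℝ × ℝ × ℝ × ℝ) : ℝ := a.2.2.2

/-- The value at `g` of the left-invariant vector field
`T_α = ∂_{t_α} + 2x_α ∂_x + 2y_α ∂_y + 2z_α ∂_z`, as a tangent vector. -/
def Tvec (n : ℕ) (α : Fin n) (g : QH n) : QH n :=
  (Pi.single α (1, 0, 0, 0),
    (2 * xC (g.1 α), 2 * yC (g.1 α), 2 * zC (g.1 α)))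

/-- The value at `g` of `X_α = ∂_{x_α} − 2t_α ∂_x − 2z_α ∂_y + 2y_α ∂_z`. -/
def Xvec (n : ℕ) (α : Fin n) (g : QH n) : QH n :=
  (Pi.single α (0, 1, 0, 0),
    (-2 * tC (g.1 α), -2 * zC (g.1 α), 2 * yC (g.1 α)))

/-- The value at `g` of `Y_α = ∂_{y_α} + 2z_α ∂_x − 2t_α ∂_y − 2x_α ∂_z`. -/
def Yvec (n : ℕ) (α : Fin n) (g : QH n) : QH n :=
  (Pi.single α (0, 0, 1, 0),
    (2 * zC (g.1 α), -2 * tC (g.1 α), -2 * xC (g.1 α)))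

/-- The value at `g` of `Z_α = ∂_{z_α} − 2y_α ∂_x + 2x_α ∂_y − 2t_α ∂_z`. -/
def Zvec (n : ℕ) (α : Fin n) (g : QH n) : QH n :=
  (Pi.single α (0, 0, 0, 1),
    (-2 * yC (g.1 α), 2 * xC (g.1 α), -2 * tC (g.1 α)))

/-- Derivative of `u` along `T_α`. -/
noncomputable def TD (n : ℕ) (α : Fin n) (u : QH n → ℝ) (g : QH n) : ℝ :=
  fderiv ℝ u g (Tvec n α g)
/-- Derivative of `u` along `X_α`. -/
noncomputable def XD (n : ℕ) (α : Fin n) (u : QH n → ℝ) (g : QH n) : ℝ :=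
  fderiv ℝ u g (Xvec n α g)
/-- Derivative of `u` along `Y_α`. -/
noncomputable def YD (n : ℕ) (α : Fin n) (u : QH n → ℝ) (g : QH n) : ℝ :=
  fderiv ℝ u g (Yvec n α g)
/-- Derivative of `u` along `Z_α`. -/
noncomputable def ZD (n : ℕ) (α : Fin n) (u : QH n → ℝ) (g : QH n) : ℝ :=
  fderiv ℝ u g (Zvec n α g)

/-- Square of the length of the horizontal gradient:
`|∇u|² = Σ_α ((T_α u)² + (X_α u)² + (Y_α u)² + (Z_α u)²)`. -/
noncomputable def hGradSq (n : ℕ) (u : QH n → ℝ) (g : QH n) : ℝ :=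
  ∑ α : Fin n, ((TD n α u g) ^ 2 + (XD n α u g) ^ 2 + (YD n α u g) ^ 2 + (ZD n α u g) ^ 2)

/-- The sub-Laplacian `Δu = Σ_α (T_α(T_α u) + X_α(X_α u) + Y_α(Y_α u) + Z_α(Z_α u))`. -/
noncomputable def subLap (n : ℕ) (u : QH n → ℝ) (g : QH n) : ℝ :=
  ∑ α : Fin n, (TD n α (TD n α u) g + XD n α (XD n α u) g
    + YD n α (YD n α u) g + ZD n α (ZD n α u) g)

/-- `|q|² = Σ_α (t_α² + x_α² + y_α² + z_α²)`. -/
def qSq (n : ℕ) (g : QH n) : ℝ :=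
  ∑ α : Fin n, ((tC (g.1 α)) ^ 2 + (xC (g.1 α)) ^ 2 + (yC (g.1 α)) ^ 2 + (zC (g.1 α)) ^ 2)

/-- `|ω|² = x² + y² + z²`. -/
def wSq (n : ℕ) (g : QH n) : ℝ := g.2.1 ^ 2 + g.2.2.1 ^ 2 + g.2.2.2 ^ 2

/-- `i`-component of `Im (a·b̄)` for quaternions given as coordinate quadruples. -/
def imI (a b : ℝ × ℝ × ℝ × ℝ) : ℝ :=
  -tC a * xC b + xC a * tC b - yC a * zC b + zC a * yC b

/-- `j`-component of `Im (a·b̄)`. -/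
def imJ (a b : ℝ × ℝ × ℝ × ℝ) : ℝ :=
  -tC a * yC b + xC a * zC b + yC a * tC b - zC a * xC b

/-- `k`-component of `Im (a·b̄)`. -/
def imK (a b : ℝ × ℝ × ℝ × ℝ) : ℝ :=
  -tC a * zC b - xC a * yC b + yC a * xC b + zC a * tC b

/-- The group law `(q₀,ω₀)∘(q,ω) = (q₀+q, ω+ω₀+2 Im(q₀ q̄))`. -/
def op (n : ℕ) (a g : QH n) : QH n :=
  (a.1 + g.1,
    (g.2.1 + a.2.1 + 2 * ∑ α : Fin n, imI (a.1 α) (g.1 α),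
     g.2.2.1 + a.2.2.1 + 2 * ∑ α : Fin n, imJ (a.1 α) (g.1 α),
     g.2.2.2 + a.2.2.2 + 2 * ∑ α : Fin n, imK (a.1 α) (g.1 α)))

/-- The anisotropic dilations `δ_λ(q,ω) = (λq, λ²ω)`. -/
def dil (n : ℕ) (lam : ℝ) (g : QH n) : QH n :=
  (fun α => (lam * tC (g.1 α), lam * xC (g.1 α), lam * yC (g.1 α), lam * zC (g.1 α)),
    (lam ^ 2 * g.2.1, lam ^ 2 * g.2.2.1, lam ^ 2 * g.2.2.2))

end QH

open Set in
/-- The flow of a shear field `(x, y) ↦ (e, L x)` with `L` invariant along `e` consists of the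
measure-preserving maps `(x, y) ↦ (x + s e, y + s L x)`, so the integral of a derivative along the
field vanishes. -/
theorem integral_fderiv_shear_eq_zero {E F : Type*}
    [NormedAddCommGroup E] [NormedSpace ℝ E] [MeasureSpace E] [BorelSpace E]
    [SecondCountableTopology E] [SFinite (volume : Measure E)]
    [(volume : Measure E).IsAddRightInvariant]
    [NormedAddCommGroup F] [NormedSpace ℝ F] [MeasureSpace F] [BorelSpace F]
    [SecondCountableTopology F] [SFinite (volume : Measure F)]
    [(volume : Measure F).IsAddRightInvariant]
    (e : E) (L : E → F) (hL : Continuous L) (hLe : ∀ x (s : ℝ), L (x + s • e) = L x)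
    (f : E × F → ℝ) (hf : ContDiff ℝ 1 f) (hfi : Integrable f)
    (hdf : Integrable fun g : E × F => fderiv ℝ f g (e, L g.1)) :
    ∫ g : E × F, fderiv ℝ f g (e, L g.1) = 0 := by
  have hflow : ∀ s : ℝ, MeasurePreserving
      (fun g : E × F => (g.1 + s • e, g.2 + s • L g.1)) volume volume := fun s =>
    (measurePreserving_add_right (volume : Measure E) (s • e)).skew_product
      (g := fun x y => y + s • L x) (by fun_prop)
      (.of_forall fun x => (measurePreserving_add_right (volume : Measure F) (s • L x)).map_eq)
  have hprod : MeasurePreserving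
      (fun z : ℝ × (E × F) => (z.1, (z.2.1 + z.1 • e, z.2.2 + z.1 • L z.2.1)))
      ((volume.restrict (Ioc (0 : ℝ) 1)).prod volume)
      ((volume.restrict (Ioc (0 : ℝ) 1)).prod volume) :=
    (MeasurePreserving.id _).skew_product
      (g := fun (s : ℝ) (g : E × F) => (g.1 + s • e, g.2 + s • L g.1)) (by fun_prop)
      (.of_forall fun s => (hflow s).map_eq)
  set h : E × F → ℝ := fun g => fderiv ℝ f g (e, L g.1) with hh
  have hhc : Continuous h :=
    (hf.continuous_fderiv one_ne_zero).clm_apply (by fun_prop)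
  have hint : Integrable (fun z : ℝ × (E × F) => h z.2)
      ((volume.restrict (Ioc (0 : ℝ) 1)).prod volume) := hdf.comp_snd _
  have hint' : Integrable
      (fun z : ℝ × (E × F) => h (z.2.1 + z.1 • e, z.2.2 + z.1 • L z.2.1))
      ((volume.restrict (Ioc (0 : ℝ) 1)).prod volume) := hprod.integrable_comp_of_integrable hint
  have hline : ∀ g : E × F, ∫ s in Ioc (0 : ℝ) 1, h (g.1 + s • e, g.2 + s • L g.1)
      = f (g.1 + (1 : ℝ) • e, g.2 + (1 : ℝ) • L g.1) - f g := by
    intro g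
    rw [← intervalIntegral.integral_of_le zero_le_one,
      intervalIntegral.integral_eq_sub_of_hasDerivAt
        (f := fun s : ℝ => f (g.1 + s • e, g.2 + s • L g.1))]
    · simp
    · intro s _
      have hγ : HasDerivAt (fun s : ℝ => (g.1 + s • e, g.2 + s • L g.1)) (e, L g.1) s := by
        simpa using (((hasDerivAt_id s).smul_const e).const_add g.1).prodMk
          (((hasDerivAt_id s).smul_const (L g.1)).const_add g.2)
      have := ((hf.differentiable one_ne_zero) _).hasFDerivAt.comp_hasDerivAt s hγ
      simpa [hh, hLe, Function.comp_def] using this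
    · exact (hhc.comp (by fun_prop)).intervalIntegrable _ _
  calc ∫ g, h g
      = ∫ z, h z.2 ∂((volume.restrict (Ioc (0 : ℝ) 1)).prod volume) := by
        rw [integral_fun_snd]; simp
    _ = ∫ z : ℝ × (E × F), h (z.2.1 + z.1 • e, z.2.2 + z.1 • L z.2.1)
          ∂((volume.restrict (Ioc (0 : ℝ) 1)).prod volume) := by
        have := integral_map hprod.measurable.aemeasurable
          (f := fun z : ℝ × (E × F) => h z.2) (by rw [hprod.map_eq]; exact hint.1)
        rw [hprod.map_eq] at this
        exact this
    _ = ∫ g : E × F, ∫ s in Ioc (0 : ℝ) 1, h (g.1 + s • e, g.2 + s • L g.1) :=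
        integral_prod_symm _ hint'
    _ = ∫ g : E × F, (f (g.1 + (1 : ℝ) • e, g.2 + (1 : ℝ) • L g.1) - f g) := by
        simp_rw [hline]
    _ = 0 := by
        rw [integral_sub
          (f := fun g : E × F => f (g.1 + (1 : ℝ) • e, g.2 + (1 : ℝ) • L g.1))
          ((hflow 1).integrable_comp_of_integrable hfi) hfi]
        have := integral_map (hflow 1).measurable.aemeasurable (f := f)
          (by rw [(hflow 1).map_eq]; exact hfi.1)
        rw [(hflow 1).map_eq] at this
        rw [← this, sub_self]

/-- If `P` and `S` are the first and second derivatives of `Φ` along a shear field `W` and are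
dominated by `Φ ∈ L²`, then the energy density of `GΦ` along `W` differs from
`Φ² (W G)² - G² Φ S` by a divergence, which integrates to zero. -/
theorem integral_shear_energy_defect {E F : Type*}
    [NormedAddCommGroup E] [NormedSpace ℝ E] [MeasureSpace E] [BorelSpace E]
    [SecondCountableTopology E] [SFinite (volume : Measure E)]
    [(volume : Measure E).IsAddRightInvariant]
    [NormedAddCommGroup F] [NormedSpace ℝ F] [MeasureSpace F] [BorelSpace F]
    [SecondCountableTopology F] [SFinite (volume : Measure F)]
    [(volume : Measure F).IsAddRightInvariant]
    (e : E) (L : E → F) (hL : Continuous L) (hLe : ∀ x (s : ℝ), L (x + s • e) = L x)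
    (G Φ P S : E × F → ℝ) (hG : ContDiff ℝ 1 G) (hΦ : ContDiff ℝ 1 Φ) (hP : ContDiff ℝ 1 P)
    (hWΦ : ∀ g, fderiv ℝ Φ g (e, L g.1) = P g) (hWP : ∀ g, fderiv ℝ P g (e, L g.1) = S g)
    (M N C : ℝ) (hGM : ∀ g, |G g| ≤ M) (hGN : ∀ g, |fderiv ℝ G g (e, L g.1)| ≤ N)
    (hPC : ∀ g, |P g| ≤ C * |Φ g|) (hSC : ∀ g, |S g| ≤ C * |Φ g|)
    (hΦi : Integrable fun g => Φ g ^ 2) :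
    Integrable (fun g => (fderiv ℝ (fun x => G x * Φ x) g (e, L g.1)) ^ 2
      - Φ g ^ 2 * (fderiv ℝ G g (e, L g.1)) ^ 2 + G g ^ 2 * Φ g * S g) ∧
    ∫ g, ((fderiv ℝ (fun x => G x * Φ x) g (e, L g.1)) ^ 2
      - Φ g ^ 2 * (fderiv ℝ G g (e, L g.1)) ^ 2 + G g ^ 2 * Φ g * S g) = 0 := by
  have hGd := hG.differentiable one_ne_zero
  have hΦd := hΦ.differentiable one_ne_zero
  have hPd := hP.differentiable one_ne_zero
  have hcont : ∀ u : E × F → ℝ, ContDiff ℝ 1 u →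
      Continuous fun g : E × F => fderiv ℝ u g (e, L g.1) := fun u hu =>
    (hu.continuous_fderiv one_ne_zero).clm_apply (by fun_prop)
  have hf : ContDiff ℝ 1 fun g => G g ^ 2 * Φ g * P g := ((hG.pow 2).mul hΦ).mul hP
  have hdf' : ∀ g, fderiv ℝ (fun g => G g ^ 2 * Φ g * P g) g (e, L g.1)
      = 2 * G g * fderiv ℝ G g (e, L g.1) * Φ g * P g + G g ^ 2 * P g * P g
        + G g ^ 2 * Φ g * S g := by
    intro g
    have h : HasFDerivAt (fun g => G g ^ 2 * Φ g * P g) _ g :=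
      (((hGd g).hasFDerivAt.pow 2).mul (hΦd g).hasFDerivAt).mul (hPd g).hasFDerivAt
    rw [h.fderiv]
    simp [hWΦ, hWP]
    ring
  have hdf : ∀ g, fderiv ℝ (fun g => G g ^ 2 * Φ g * P g) g (e, L g.1)
      = (fderiv ℝ (fun x => G x * Φ x) g (e, L g.1)) ^ 2
        - Φ g ^ 2 * (fderiv ℝ G g (e, L g.1)) ^ 2 + G g ^ 2 * Φ g * S g := by
    intro g
    have h : HasFDerivAt (fun x => G x * Φ x) _ g := (hGd g).hasFDerivAt.mul (hΦd g).hasFDerivAt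
    rw [hdf', h.fderiv]
    simp [hWΦ]
    ring
  have hbound : ∀ (a b c : E × F → ℝ) (m k l : ℝ),
      (∀ g, |a g| ≤ m) → (∀ g, |b g| ≤ k * |Φ g|) → (∀ g, |c g| ≤ l * |Φ g|) →
      ∀ g, |a g * b g * c g| ≤ m * k * l * Φ g ^ 2 := by
    intro a b c m k l ha hb hc g
    rw [abs_mul, abs_mul]
    calc |a g| * |b g| * |c g| ≤ m * (k * |Φ g|) * (l * |Φ g|) := by
          have := (abs_nonneg (a g)).trans (ha g)
          have := (abs_nonneg (b g)).trans (hb g)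
          gcongr
          exacts [ha g, hb g, hc g]
      _ = m * k * l * Φ g ^ 2 := by rw [← sq_abs (Φ g)]; ring
  have hG2 : ∀ g, |G g ^ 2| ≤ M ^ 2 := fun g => by
    rw [abs_pow]; exact pow_le_pow_left₀ (abs_nonneg _) (hGM g) 2
  have hGG : ∀ g, |2 * G g * fderiv ℝ G g (e, L g.1)| ≤ 2 * M * N := fun g => by
    rw [abs_mul, abs_mul, abs_two]
    have := (abs_nonneg (G g)).trans (hGM g)
    gcongr
    exacts [hGM g, hGN g]
  have hΦ1 : ∀ g, |Φ g| ≤ 1 * |Φ g| := fun g => (one_mul _).ge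
  have hfi : Integrable fun g => G g ^ 2 * Φ g * P g :=
    (hΦi.const_mul (M ^ 2 * 1 * C)).mono' hf.continuous.aestronglyMeasurable
      (.of_forall fun g => hbound _ _ _ _ _ _ hG2 hΦ1 hPC g)
  have hdfi : Integrable fun g : E × F =>
      fderiv ℝ (fun g => G g ^ 2 * Φ g * P g) g (e, L g.1) := by
    refine ((hΦi.const_mul (2 * M * N * 1 * C)).add ((hΦi.const_mul (M ^ 2 * C * C)).add
      (hΦi.const_mul (M ^ 2 * 1 * C)))).mono' (hcont _ hf).aestronglyMeasurable
      (.of_forall fun g => ?_)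
    rw [hdf', Real.norm_eq_abs, add_assoc]
    refine (abs_add_le _ _).trans (add_le_add ?_ ((abs_add_le _ _).trans (add_le_add ?_ ?_)))
    exacts [hbound _ _ _ _ _ _ hGG hΦ1 hPC g, hbound _ _ _ _ _ _ hG2 hPC hPC g,
      hbound _ _ _ _ _ _ hG2 hΦ1 hSC g]
  have hzero := integral_fderiv_shear_eq_zero e L hL hLe _ hf hfi hdfi
  simp_rw [hdf] at hdfi hzero
  exact ⟨hdfi, hzero⟩

namespace QH

/-- The squared norm of a quaternion given as a coordinate quadruple. -/
def nSq (a : ℝ × ℝ × ℝ × ℝ) : ℝ := tC a ^ 2 + xC a ^ 2 + yC a ^ 2 + zC a ^ 2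

/-- The real part of `a·b̄`. -/
def rePart (a b : ℝ × ℝ × ℝ × ℝ) : ℝ :=
  tC a * tC b + xC a * xC b + yC a * yC b + zC a * zC b

/-- The vertical component `2 Im (q_α v̄)` of the left-invariant field in direction `v`. -/
def vertPart (n : ℕ) (α : Fin n) (v : ℝ × ℝ × ℝ × ℝ) (q : Fin n → ℝ × ℝ × ℝ × ℝ) : ℝ × ℝ × ℝ :=
  (2 * imI (q α) v, 2 * imJ (q α) v, 2 * imK (q α) v)

theorem Tvec_eq (n : ℕ) (α : Fin n) (g : QH n) :
    Tvec n α g = (Pi.single α (1, 0, 0, 0), vertPart n α (1, 0, 0, 0) g.1) := by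
  simp [Tvec, vertPart, imI, imJ, imK, tC, xC, yC, zC]

theorem Xvec_eq (n : ℕ) (α : Fin n) (g : QH n) :
    Xvec n α g = (Pi.single α (0, 1, 0, 0), vertPart n α (0, 1, 0, 0) g.1) := by
  simp [Xvec, vertPart, imI, imJ, imK, tC, xC, yC, zC]

theorem Yvec_eq (n : ℕ) (α : Fin n) (g : QH n) :
    Yvec n α g = (Pi.single α (0, 0, 1, 0), vertPart n α (0, 0, 1, 0) g.1) := by
  simp [Yvec, vertPart, imI, imJ, imK, tC, xC, yC, zC]

theorem Zvec_eq (n : ℕ) (α : Fin n) (g : QH n) :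
    Zvec n α g = (Pi.single α (0, 0, 0, 1), vertPart n α (0, 0, 0, 1) g.1) := by
  simp [Zvec, vertPart, imI, imJ, imK, tC, xC, yC, zC]

theorem vertPart_add_smul_single (n : ℕ) (α : Fin n) (v : ℝ × ℝ × ℝ × ℝ)
    (q : Fin n → ℝ × ℝ × ℝ × ℝ) (s : ℝ) :
    vertPart n α v (q + s • (Pi.single α v : Fin n → ℝ × ℝ × ℝ × ℝ)) = vertPart n α v q := by
  simp only [vertPart, imI, imJ, imK, tC, xC, yC, zC, Pi.add_apply, Pi.smul_apply,
    Pi.single_eq_same, Prod.fst_add, Prod.snd_add, Prod.smul_fst, Prod.smul_snd, smul_eq_mul]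
  refine Prod.ext ?_ (Prod.ext ?_ ?_) <;> simp only <;> ring

theorem continuous_vertPart (n : ℕ) (α : Fin n) (v : ℝ × ℝ × ℝ × ℝ) :
    Continuous (vertPart n α v) := by
  unfold vertPart imI imJ imK tC xC yC zC
  fun_prop

theorem contDiff_qSq (n : ℕ) : ContDiff ℝ 1 (qSq n) := by
  unfold qSq tC xC yC zC
  fun_prop

theorem contDiff_wSq (n : ℕ) : ContDiff ℝ 1 (wSq n) := by
  unfold wSq
  fun_prop

/-- The function `(1 + |q|²)² + |ω|²`. -/
def gauge (n : ℕ) (g : QH n) : ℝ := (1 + qSq n g) ^ 2 + wSq n g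

/-- The derivative of `gauge` along the left-invariant field in direction `v`. -/
def gaugeD (n : ℕ) (α : Fin n) (v : ℝ × ℝ × ℝ × ℝ) (g : QH n) : ℝ :=
  4 * ((1 + qSq n g) * rePart (g.1 α) v
    + (g.2.1 * imI (g.1 α) v + g.2.2.1 * imJ (g.1 α) v + g.2.2.2 * imK (g.1 α) v))

theorem contDiff_gauge (n : ℕ) : ContDiff ℝ 1 (gauge n) :=
  ((contDiff_const.add (contDiff_qSq n)).pow 2).add (contDiff_wSq n)

theorem contDiff_gaugeD (n : ℕ) (α : Fin n) (v : ℝ × ℝ × ℝ × ℝ) :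
    ContDiff ℝ 1 (gaugeD n α v) := by
  have := contDiff_qSq n
  unfold gaugeD rePart imI imJ imK tC xC yC zC
  fun_prop

theorem qSq_nonneg (n : ℕ) (g : QH n) : 0 ≤ qSq n g :=
  Finset.sum_nonneg fun _ _ => by positivity

theorem wSq_nonneg (n : ℕ) (g : QH n) : 0 ≤ wSq n g := by
  unfold wSq
  positivity

theorem nSq_le_qSq (n : ℕ) (α : Fin n) (g : QH n) : nSq (g.1 α) ≤ qSq n g :=
  Finset.single_le_sum (f := fun β => nSq (g.1 β)) (fun _ _ => by unfold nSq; positivity)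
    (Finset.mem_univ α)

theorem one_add_qSq_le_gauge (n : ℕ) (g : QH n) : 1 + qSq n g ≤ gauge n g := by
  unfold gauge
  nlinarith [qSq_nonneg n g, wSq_nonneg n g]

theorem one_le_gauge (n : ℕ) (g : QH n) : 1 ≤ gauge n g := by
  linarith [one_add_qSq_le_gauge n g, qSq_nonneg n g]

theorem rePart_sq_add_im_sq (a v : ℝ × ℝ × ℝ × ℝ) :
    rePart a v ^ 2 + (imI a v ^ 2 + imJ a v ^ 2 + imK a v ^ 2) = nSq a * nSq v := by
  unfold rePart imI imJ imK nSq
  ring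

theorem qSq_line (n : ℕ) (α : Fin n) (v : ℝ × ℝ × ℝ × ℝ) (g : QH n) (w : ℝ × ℝ × ℝ) (s : ℝ) :
    qSq n (g + s • (Pi.single α v, w)) = qSq n g + 2 * s * rePart (g.1 α) v + s ^ 2 * nSq v := by
  have h : ∀ β, nSq ((g + s • ((Pi.single α v, w) : QH n)).1 β)
      = nSq (g.1 β) + if β = α then 2 * s * rePart (g.1 α) v + s ^ 2 * nSq v else 0 := by
    intro β
    by_cases hβ : β = α
    · subst hβ
      simp [nSq, rePart, tC, xC, yC, zC]
      ring
    · simp [nSq, tC, xC, yC, zC, hβ]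
  have hsum : ∀ g' : QH n, qSq n g' = ∑ β, nSq (g'.1 β) := fun _ => rfl
  rw [hsum, hsum]
  simp_rw [h, Finset.sum_add_distrib]
  simp [add_assoc]

theorem fderiv_eq_of_hasDerivAt_line {E : Type*} [NormedAddCommGroup E] [NormedSpace ℝ E]
    {f : E → ℝ} {g v : E} {f' : ℝ} (hf : DifferentiableAt ℝ f g)
    (h : HasDerivAt (fun s : ℝ => f (g + s • v)) f' 0) : fderiv ℝ f g v = f' :=
  (hf.hasFDerivAt.hasLineDerivAt v).unique h

theorem fderiv_gauge (n : ℕ) (α : Fin n) (v : ℝ × ℝ × ℝ × ℝ) (g : QH n) :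
    fderiv ℝ (gauge n) g (Pi.single α v, vertPart n α v g.1) = gaugeD n α v g := by
  refine fderiv_eq_of_hasDerivAt_line ((contDiff_gauge n).differentiable one_ne_zero g) ?_
  simp only [gauge, qSq_line]
  simp only [wSq, vertPart, gaugeD, Prod.fst_add, Prod.snd_add, smul_eq_mul, Prod.smul_mk]
  have hid := hasDerivAt_id (0 : ℝ)
  have hlin : ∀ a b : ℝ, HasDerivAt (fun s : ℝ => (a + s * b) ^ 2) (2 * a * b) 0 := fun a b => by
    simpa using ((hid.mul_const b).const_add a).fun_pow 2
  have hq : HasDerivAt (fun s : ℝ =>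
      (1 + (qSq n g + 2 * s * rePart (g.1 α) v + s ^ 2 * nSq v)) ^ 2)
      (2 * (1 + qSq n g) * (2 * rePart (g.1 α) v)) 0 := by
    simpa using ((((((hid.const_mul 2).mul_const (rePart (g.1 α) v)).const_add (qSq n g)).fun_add
      ((hid.fun_pow 2).mul_const (nSq v))).const_add 1).fun_pow 2)
  refine (hq.fun_add (((hlin g.2.1 (2 * imI (g.1 α) v)).fun_add
    (hlin g.2.2.1 (2 * imJ (g.1 α) v))).fun_add (hlin g.2.2.2 (2 * imK (g.1 α) v)))).congr_deriv ?_
  ring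

theorem fderiv_gaugeD (n : ℕ) (α : Fin n) (v : ℝ × ℝ × ℝ × ℝ) (hv : nSq v = 1) (g : QH n) :
    fderiv ℝ (gaugeD n α v) g (Pi.single α v, vertPart n α v g.1)
      = 4 * (1 + qSq n g) + 8 * nSq (g.1 α) := by
  have hn := rePart_sq_add_im_sq (g.1 α) v
  refine fderiv_eq_of_hasDerivAt_line ((contDiff_gaugeD n α v).differentiable one_ne_zero g) ?_
  have hI : ∀ (s : ℝ), imI (g.1 α + s • v) v = imI (g.1 α) v := fun s => by
    simp only [imI, tC, xC, yC, zC, Prod.fst_add, Prod.snd_add, Prod.smul_fst, Prod.smul_snd,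
      smul_eq_mul]
    ring
  have hJ : ∀ (s : ℝ), imJ (g.1 α + s • v) v = imJ (g.1 α) v := fun s => by
    simp only [imJ, tC, xC, yC, zC, Prod.fst_add, Prod.snd_add, Prod.smul_fst, Prod.smul_snd,
      smul_eq_mul]
    ring
  have hK : ∀ (s : ℝ), imK (g.1 α + s • v) v = imK (g.1 α) v := fun s => by
    simp only [imK, tC, xC, yC, zC, Prod.fst_add, Prod.snd_add, Prod.smul_fst, Prod.smul_snd,
      smul_eq_mul]
    ring
  have hR : ∀ (s : ℝ), rePart (g.1 α + s • v) v = rePart (g.1 α) v + s := fun s => by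
    conv_rhs => rw [← mul_one s, ← hv]
    simp only [rePart, nSq, tC, xC, yC, zC, Prod.fst_add, Prod.snd_add, Prod.smul_fst,
      Prod.smul_snd, smul_eq_mul]
    ring
  simp only [gaugeD, qSq_line]
  simp only [vertPart, Prod.fst_add, Prod.snd_add, smul_eq_mul, Prod.smul_mk,
    Pi.add_apply, Pi.smul_apply, Pi.single_eq_same,
    hI, hJ, hK, hR]
  have hid := hasDerivAt_id (0 : ℝ)
  have hlin : ∀ a b c : ℝ, HasDerivAt (fun s : ℝ => (a + s * b) * c) (b * c) 0 := fun a b c => by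
    simpa using ((hid.mul_const b).const_add a).mul_const c
  have hq : HasDerivAt (fun s : ℝ =>
      (1 + (qSq n g + 2 * s * rePart (g.1 α) v + s ^ 2 * nSq v)) * (rePart (g.1 α) v + s))
      (2 * rePart (g.1 α) v * rePart (g.1 α) v + (1 + qSq n g)) 0 := by
    simpa using ((((((hid.const_mul 2).mul_const (rePart (g.1 α) v)).const_add (qSq n g)).fun_add
      ((hid.fun_pow 2).mul_const (nSq v))).const_add 1).fun_mul (hid.const_add (rePart (g.1 α) v)))
  refine ((hq.fun_add (((hlin g.2.1 (2 * imI (g.1 α) v) (imI (g.1 α) v)).fun_add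
    (hlin g.2.2.1 (2 * imJ (g.1 α) v) (imJ (g.1 α) v))).fun_add
    (hlin g.2.2.2 (2 * imK (g.1 α) v) (imK (g.1 α) v)))).const_mul 4).congr_deriv ?_
  rw [hv] at hn
  linear_combination 8 * hn

theorem gaugeD_sq_le (n : ℕ) (α : Fin n) (v : ℝ × ℝ × ℝ × ℝ) (hv : nSq v = 1) (g : QH n) :
    gaugeD n α v g ^ 2 ≤ 16 * (gauge n g * nSq (g.1 α)) := by
  have hn := rePart_sq_add_im_sq (g.1 α) v
  rw [hv, mul_one] at hn
  rw [← hn]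
  unfold gaugeD gauge wSq
  generalize 1 + qSq n g = a
  generalize rePart (g.1 α) v = p, imI (g.1 α) v = i, imJ (g.1 α) v = j, imK (g.1 α) v = k
  generalize g.2.1 = x, g.2.2.1 = y, g.2.2.2 = z
  nlinarith [sq_nonneg (a * i - x * p), sq_nonneg (a * j - y * p), sq_nonneg (a * k - z * p),
    sq_nonneg (x * j - y * i), sq_nonneg (x * k - z * i), sq_nonneg (y * k - z * j)]

theorem abs_gaugeD_le (n : ℕ) (α : Fin n) (v : ℝ × ℝ × ℝ × ℝ) (hv : nSq v = 1) (g : QH n) :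
    |gaugeD n α v g| ≤ 4 * gauge n g := by
  have h1 := one_le_gauge n g
  refine abs_le_of_sq_le_sq ((gaugeD_sq_le n α v hv g).trans ?_) (by linarith)
  nlinarith [nSq_le_qSq n α g, one_add_qSq_le_gauge n g]

theorem sum_gaugeD_sq (n : ℕ) (α : Fin n) (g : QH n) :
    gaugeD n α (1, 0, 0, 0) g ^ 2 + gaugeD n α (0, 1, 0, 0) g ^ 2
      + gaugeD n α (0, 0, 1, 0) g ^ 2 + gaugeD n α (0, 0, 0, 1) g ^ 2
      = 16 * (gauge n g * nSq (g.1 α)) := by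
  simp only [gaugeD, gauge, wSq, rePart, imI, imJ, imK, nSq, tC, xC, yC, zC]
  ring

theorem norm_sq_le_qSq (n : ℕ) (g : QH n) : ‖g.1‖ ^ 2 ≤ qSq n g := by
  have h : ‖g.1‖ ≤ √(qSq n g) := by
    refine (pi_norm_le_iff_of_nonneg (Real.sqrt_nonneg _)).2 fun α => ?_
    have hα := nSq_le_qSq n α g
    unfold nSq tC xC yC zC at hα
    simp only [Prod.norm_def, Real.norm_eq_abs, max_le_iff]
    refine ⟨?_, ?_, ?_, ?_⟩ <;> apply Real.abs_le_sqrt <;>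
      nlinarith [sq_nonneg (g.1 α).1, sq_nonneg (g.1 α).2.1, sq_nonneg (g.1 α).2.2.1,
        sq_nonneg (g.1 α).2.2.2]
  calc ‖g.1‖ ^ 2 ≤ √(qSq n g) ^ 2 := pow_le_pow_left₀ (norm_nonneg _) h 2
    _ = qSq n g := Real.sq_sqrt (qSq_nonneg n g)

theorem norm_sq_le_wSq (n : ℕ) (g : QH n) : ‖g.2‖ ^ 2 ≤ wSq n g := by
  have h : ‖g.2‖ ≤ √(wSq n g) := by
    simp only [Prod.norm_def, Real.norm_eq_abs, max_le_iff]
    refine ⟨?_, ?_, ?_⟩ <;> apply Real.abs_le_sqrt <;> unfold wSq <;>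
      nlinarith [sq_nonneg g.2.1, sq_nonneg g.2.2.1, sq_nonneg g.2.2.2]
  calc ‖g.2‖ ^ 2 ≤ √(wSq n g) ^ 2 := pow_le_pow_left₀ (norm_nonneg _) h 2
    _ = wSq n g := Real.sq_sqrt (wSq_nonneg n g)

instance isAddHaarMeasure_volume_im : (volume : Measure (ℝ × ℝ × ℝ)).IsAddHaarMeasure :=
  have : (volume : Measure (ℝ × ℝ)).IsAddHaarMeasure :=
    Measure.prod.instIsAddHaarMeasure volume volume
  Measure.prod.instIsAddHaarMeasure volume volume

instance isAddHaarMeasure_volume_quaternion :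
    (volume : Measure (ℝ × ℝ × ℝ × ℝ)).IsAddHaarMeasure :=
  Measure.prod.instIsAddHaarMeasure volume volume

instance isAddHaarMeasure_volume_fin (n : ℕ) :
    (volume : Measure (Fin n → ℝ × ℝ × ℝ × ℝ)).IsAddHaarMeasure :=
  Measure.instIsAddHaarMeasureForallVolumeOfMeasurableAddOfSigmaFinite

theorem integrable_inv_gauge_pow (n : ℕ) (hn : 1 ≤ n) :
    Integrable fun g : QH n => (gauge n g)⁻¹ ^ (2 * (n + 1)) := by
  have h1 : Integrable fun q : Fin n → ℝ × ℝ × ℝ × ℝ =>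
      (1 + ‖q‖ ^ 2) ^ (-((8 * n : ℕ) : ℝ) / 2) := by
    refine integrable_rpow_neg_one_add_norm_sq ?_
    simp only [Module.finrank_pi_fintype, Module.finrank_prod, Module.finrank_self]
    simp
    norm_cast
    omega
  have h2 : Integrable fun w : ℝ × ℝ × ℝ => (1 + ‖w‖ ^ 2) ^ (-(4 : ℝ) / 2) := by
    refine integrable_rpow_neg_one_add_norm_sq ?_
    simp only [Module.finrank_prod, Module.finrank_self]
    norm_num
  have hcont : Continuous fun g : QH n => (gauge n g)⁻¹ ^ (2 * (n + 1)) :=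
    ((contDiff_gauge n).continuous.inv₀ fun g => by linarith [one_le_gauge n g]).pow _
  refine (h1.mul_prod h2).mono' hcont.aestronglyMeasurable (.of_forall fun g => ?_)
  have hD := one_le_gauge n g
  have hq := norm_sq_le_qSq n g
  have hw := norm_sq_le_wSq n g
  have e1 : (1 + ‖g.1‖ ^ 2) ^ (-((8 * n : ℕ) : ℝ) / 2) = ((1 + ‖g.1‖ ^ 2) ^ 2)⁻¹ ^ (2 * n) := by
    rw [show (-((8 * n : ℕ) : ℝ) / 2) = -((4 * n : ℕ) : ℝ) by push_cast; ring,
      Real.rpow_neg (by positivity), Real.rpow_natCast, inv_pow, ← pow_mul]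
    congr 2
    ring
  have e2 : (1 + ‖g.2‖ ^ 2) ^ (-(4 : ℝ) / 2) = (1 + ‖g.2‖ ^ 2)⁻¹ ^ 2 := by
    rw [show (-(4 : ℝ) / 2) = -((2 : ℕ) : ℝ) by norm_num,
      Real.rpow_neg (by positivity), Real.rpow_natCast, inv_pow]
  rw [e1, e2, Real.norm_of_nonneg (by positivity), show 2 * (n + 1) = 2 * n + 2 by ring, pow_add]
  gcongr
  · unfold gauge
    nlinarith [wSq_nonneg n g, pow_le_pow_left₀ (by positivity) (add_le_add_right hq 1) 2]
  · unfold gauge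
    nlinarith [qSq_nonneg n g]

theorem continuous_hGradSq (n : ℕ) {u : QH n → ℝ} (hu : ContDiff ℝ 1 u) :
    Continuous (hGradSq n u) := by
  have h : ∀ (α : Fin n) (v : ℝ × ℝ × ℝ × ℝ), Continuous fun g : QH n =>
      fderiv ℝ u g (Pi.single α v, vertPart n α v g.1) := fun α v => by
    have := continuous_vertPart n α v
    exact (hu.continuous_fderiv one_ne_zero).clm_apply (by fun_prop)
  unfold hGradSq TD XD YD ZD
  simp_rw [Tvec_eq, Xvec_eq, Yvec_eq, Zvec_eq]
  have := fun α => h α (1, 0, 0, 0)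
  have := fun α => h α (0, 1, 0, 0)
  have := fun α => h α (0, 0, 1, 0)
  have := fun α => h α (0, 0, 0, 1)
  fun_prop

/-- The derivative of `gauge⁻¹ ^ k` along the left-invariant field in direction `v`. -/
theorem fderiv_inv_gauge_pow (n k : ℕ) (α : Fin n) (v : ℝ × ℝ × ℝ × ℝ) (g : QH n) :
    fderiv ℝ (fun g => (gauge n g)⁻¹ ^ (k + 1)) g (Pi.single α v, vertPart n α v g.1)
      = -((k + 1) * gaugeD n α v g * (gauge n g)⁻¹ ^ (k + 2)) := by
  have h0 : gauge n g ≠ 0 := by linarith [one_le_gauge n g]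
  have h : HasFDerivAt (fun g => (gauge n g)⁻¹ ^ (k + 1)) _ g :=
    ((hasDerivAt_inv h0).pow (k + 1)).comp_hasFDerivAt g
      ((contDiff_gauge n).differentiable one_ne_zero g).hasFDerivAt
  rw [h.fderiv, smul_apply, fderiv_gauge, smul_eq_mul, Nat.add_sub_cancel,
    ← inv_pow]
  push_cast
  ring

/-- The second derivative of `gauge⁻¹ ^ (n + 1)` along the left-invariant field in the
direction of a unit quaternion `v`. -/
noncomputable def invGaugeDD (n : ℕ) (α : Fin n) (v : ℝ × ℝ × ℝ × ℝ) (g : QH n) : ℝ :=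
  (n + 1) * ((n + 2) * gaugeD n α v g ^ 2 * (gauge n g)⁻¹ ^ (n + 3)
    - (4 * (1 + qSq n g) + 8 * nSq (g.1 α)) * (gauge n g)⁻¹ ^ (n + 2))

theorem contDiff_inv_gauge_pow (n k : ℕ) : ContDiff ℝ 1 fun g => (gauge n g)⁻¹ ^ k :=
  ((contDiff_gauge n).inv fun g => by linarith [one_le_gauge n g]).pow k

theorem fderiv_gaugeD_mul_inv_gauge_pow (n : ℕ) (α : Fin n) (v : ℝ × ℝ × ℝ × ℝ)
    (hv : nSq v = 1) (g : QH n) :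
    fderiv ℝ (fun g => -((n + 1) * gaugeD n α v g * (gauge n g)⁻¹ ^ (n + 2))) g
      (Pi.single α v, vertPart n α v g.1) = invGaugeDD n α v g := by
  have h : HasFDerivAt (fun g => -((n + 1) * gaugeD n α v g * (gauge n g)⁻¹ ^ (n + 2))) _ g :=
    ((((contDiff_gaugeD n α v).differentiable one_ne_zero g).hasFDerivAt.const_mul
      ((n : ℝ) + 1)).mul
      ((contDiff_inv_gauge_pow n (n + 2)).differentiable one_ne_zero g).hasFDerivAt).neg
  have h2 := fderiv_inv_gauge_pow n (n + 1) α v g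
  rw [h.fderiv]
  simp only [neg_apply, add_apply,
    smul_apply, smul_eq_mul, h2, fderiv_gaugeD n α v hv, invGaugeDD]
  push_cast
  ring

theorem inv_gauge_pow_succ_mul_gauge (n k : ℕ) (g : QH n) :
    (gauge n g)⁻¹ ^ (k + 1) * gauge n g = (gauge n g)⁻¹ ^ k := by
  rw [pow_succ, inv_mul_cancel_right₀ (by linarith [one_le_gauge n g])]

theorem abs_inv_gauge_pow_deriv_le (n : ℕ) (α : Fin n) (v : ℝ × ℝ × ℝ × ℝ)
    (hv : nSq v = 1) (g : QH n) :
    |-((n + 1) * gaugeD n α v g * (gauge n g)⁻¹ ^ (n + 2))|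
      ≤ 4 * (n + 1) * (gauge n g)⁻¹ ^ (n + 1) := by
  have hD : 0 < gauge n g := by linarith [one_le_gauge n g]
  have hA := abs_gaugeD_le n α v hv g
  rw [abs_neg, abs_mul, abs_mul, abs_of_nonneg (by positivity : (0 : ℝ) ≤ n + 1),
    abs_of_nonneg (by positivity : 0 ≤ (gauge n g)⁻¹ ^ (n + 2))]
  calc (n + 1) * |gaugeD n α v g| * (gauge n g)⁻¹ ^ (n + 2)
      ≤ (n + 1) * (4 * gauge n g) * (gauge n g)⁻¹ ^ (n + 2) := by gcongr
    _ = 4 * (n + 1) * (gauge n g)⁻¹ ^ (n + 1) := by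
        linear_combination 4 * (n + 1) * inv_gauge_pow_succ_mul_gauge n (n + 1) g

theorem abs_invGaugeDD_le (n : ℕ) (α : Fin n) (v : ℝ × ℝ × ℝ × ℝ) (hv : nSq v = 1) (g : QH n) :
    |invGaugeDD n α v g| ≤ (n + 1) * (16 * (n + 2) + 12) * (gauge n g)⁻¹ ^ (n + 1) := by
  have hD : 0 < gauge n g := by linarith [one_le_gauge n g]
  have hA : gaugeD n α v g ^ 2 ≤ (4 * gauge n g) ^ 2 := by
    rw [← sq_abs]
    exact pow_le_pow_left₀ (abs_nonneg _) (abs_gaugeD_le n α v hv g) 2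
  have hN : 0 ≤ nSq (g.1 α) := by unfold nSq; positivity
  have hq := qSq_nonneg n g
  have hB : 4 * (1 + qSq n g) + 8 * nSq (g.1 α) ≤ 12 * gauge n g := by
    linarith [nSq_le_qSq n α g, one_add_qSq_le_gauge n g]
  unfold invGaugeDD
  rw [abs_mul, abs_of_nonneg (by positivity : (0 : ℝ) ≤ n + 1), mul_assoc ((n : ℝ) + 1)]
  refine mul_le_mul_of_nonneg_left ?_ (by positivity)
  refine (abs_sub_le _ 0 _).trans ?_
  rw [sub_zero, zero_sub, abs_neg, abs_of_nonneg (by positivity), abs_of_nonneg (by positivity)]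
  calc (n + 2) * gaugeD n α v g ^ 2 * (gauge n g)⁻¹ ^ (n + 3)
        + (4 * (1 + qSq n g) + 8 * nSq (g.1 α)) * (gauge n g)⁻¹ ^ (n + 2)
      ≤ (n + 2) * (4 * gauge n g) ^ 2 * (gauge n g)⁻¹ ^ (n + 3)
        + 12 * gauge n g * (gauge n g)⁻¹ ^ (n + 2) := by gcongr
    _ = (16 * (n + 2) + 12) * (gauge n g)⁻¹ ^ (n + 1) := by
        linear_combination (16 * (n + 2) + 12) * inv_gauge_pow_succ_mul_gauge n (n + 1) g
          + 16 * (n + 2) * gauge n g * inv_gauge_pow_succ_mul_gauge n (n + 2) g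

/-- `gauge⁻¹ ^ (n + 1)` solves the Yamabe equation. -/
theorem sum_invGaugeDD (n : ℕ) (g : QH n) :
    ∑ α, (invGaugeDD n α (1, 0, 0, 0) g + invGaugeDD n α (0, 1, 0, 0) g
      + invGaugeDD n α (0, 0, 1, 0) g + invGaugeDD n α (0, 0, 0, 1) g)
      = -(16 * n * (n + 1) * (gauge n g)⁻¹ ^ (n + 2)) := by
  have hterm : ∀ α, invGaugeDD n α (1, 0, 0, 0) g + invGaugeDD n α (0, 1, 0, 0) g
      + invGaugeDD n α (0, 0, 1, 0) g + invGaugeDD n α (0, 0, 0, 1) g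
      = (n + 1) * (gauge n g)⁻¹ ^ (n + 2) * (16 * n * nSq (g.1 α) - 16 * (1 + qSq n g)) := by
    intro α
    have hs := sum_gaugeD_sq n α g
    have hu := inv_gauge_pow_succ_mul_gauge n (n + 2) g
    unfold invGaugeDD
    linear_combination (n + 1) * (n + 2) * (gauge n g)⁻¹ ^ (n + 3) * hs
      + 16 * (n + 1) * (n + 2) * nSq (g.1 α) * hu
  have hq : ∑ α, nSq (g.1 α) = qSq n g := rfl
  simp_rw [hterm]
  rw [← Finset.mul_sum, Finset.sum_sub_distrib, ← Finset.mul_sum, hq]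
  simp only [Finset.sum_const, Finset.card_univ, Fintype.card_fin, nsmul_eq_mul]
  ring

/-- `integral_shear_energy_defect` for `c · gauge⁻¹ ^ (n + 1)` and the left-invariant field in the
direction of a unit quaternion. -/
theorem integral_energy_defect (n : ℕ) (hn : 1 ≤ n) (α : Fin n) (v : ℝ × ℝ × ℝ × ℝ)
    (hv : nSq v = 1) (c : ℝ) (G : QH n → ℝ) (hG : ContDiff ℝ 1 G) (M N : ℝ)
    (hGM : ∀ g, |G g| ≤ M)
    (hGN : ∀ g, |fderiv ℝ G g (Pi.single α v, vertPart n α v g.1)| ≤ N) :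
    Integrable (fun g : QH n =>
      (fderiv ℝ (fun x => G x * (c * (gauge n x)⁻¹ ^ (n + 1))) g
        (Pi.single α v, vertPart n α v g.1)) ^ 2
      - (c * (gauge n g)⁻¹ ^ (n + 1)) ^ 2
        * (fderiv ℝ G g (Pi.single α v, vertPart n α v g.1)) ^ 2
      + G g ^ 2 * (c * (gauge n g)⁻¹ ^ (n + 1)) * (c * invGaugeDD n α v g)) ∧
    ∫ g : QH n, ((fderiv ℝ (fun x => G x * (c * (gauge n x)⁻¹ ^ (n + 1))) g
        (Pi.single α v, vertPart n α v g.1)) ^ 2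
      - (c * (gauge n g)⁻¹ ^ (n + 1)) ^ 2
        * (fderiv ℝ G g (Pi.single α v, vertPart n α v g.1)) ^ 2
      + G g ^ 2 * (c * (gauge n g)⁻¹ ^ (n + 1)) * (c * invGaugeDD n α v g)) = 0 := by
  have hu : ∀ g : QH n, 0 ≤ (gauge n g)⁻¹ ^ (n + 1) := fun g => by
    have : 0 < gauge n g := by linarith [one_le_gauge n g]
    positivity
  have hP1 : ContDiff ℝ 1 fun g : QH n =>
      -((n + 1) * gaugeD n α v g * (gauge n g)⁻¹ ^ (n + 2)) :=
    ((contDiff_const.mul (contDiff_gaugeD n α v)).mul (contDiff_inv_gauge_pow n (n + 2))).neg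
  refine integral_shear_energy_defect (E := Fin n → ℝ × ℝ × ℝ × ℝ) (F := ℝ × ℝ × ℝ)
    (Pi.single α v) (vertPart n α v) (continuous_vertPart n α v)
    (vertPart_add_smul_single n α v) G (fun g => c * (gauge n g)⁻¹ ^ (n + 1))
    (fun g => c * -((n + 1) * gaugeD n α v g * (gauge n g)⁻¹ ^ (n + 2)))
    (fun g => c * invGaugeDD n α v g) hG
    (contDiff_const.mul (contDiff_inv_gauge_pow n (n + 1))) (contDiff_const.mul hP1)
    (fun g => ?_) (fun g => ?_) M N ((n + 1) * (16 * (n + 2) + 12)) hGM hGN (fun g => ?_)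
    (fun g => ?_) ?_
  · rw [fderiv_const_mul ((contDiff_inv_gauge_pow n (n + 1)).differentiable one_ne_zero g),
      smul_apply, fderiv_inv_gauge_pow, smul_eq_mul]
  · rw [fderiv_const_mul (hP1.differentiable one_ne_zero g),
      smul_apply, fderiv_gaugeD_mul_inv_gauge_pow n α v hv, smul_eq_mul]
  · rw [abs_mul c, abs_mul c, mul_left_comm, abs_of_nonneg (hu g)]
    refine mul_le_mul_of_nonneg_left ((abs_inv_gauge_pow_deriv_le n α v hv g).trans ?_)
      (abs_nonneg c)
    refine mul_le_mul_of_nonneg_right ?_ (hu g)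
    have : (0 : ℝ) ≤ n := n.cast_nonneg
    nlinarith
  · rw [abs_mul c, abs_mul c, mul_left_comm, abs_of_nonneg (hu g)]
    exact mul_le_mul_of_nonneg_left (abs_invGaugeDD_le n α v hv g) (abs_nonneg c)
  · refine ((integrable_inv_gauge_pow n hn).const_mul (c ^ 2)).congr (.of_forall fun g => ?_)
    simp only
    ring

end QH

/-- Dirichlet energy identity.  With
`Φ(q,ω) = 8^{n+1}[(1+|q|²)² + |ω|²]^{−(n+1)}` and `K = (Q−2)(Q−6)/8 = 2n(n+1)`, for every
smooth bounded `G` with bounded horizontal gradient one has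
`∫ |∇(GΦ)|² dH = ∫ (Φ² |∇G|² + K G² Φ^{2*}) dH`, all integrals being finite. -/
theorem dirichlet_energy_identity (n : ℕ) (hn : 1 ≤ n)
    (Q p K : ℝ)
    (hQ : Q = 4 * n + 6)
    (hp : p = 2 * Q / (Q - 2))
    (hK : K = (Q - 2) * (Q - 6) / 8)
    (Φ : QH n → ℝ)
    (hΦ : Φ = fun g => 8 ^ (n + 1) * (((1 + QH.qSq n g) ^ 2 + QH.wSq n g) ^ (n + 1))⁻¹)
    (G : QH n → ℝ) (hG : ContDiff ℝ (⊤ : ℕ∞) G)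
    (hGbd : ∃ M : ℝ, ∀ g, |G g| ≤ M)
    (hGgradbd : ∃ M' : ℝ, ∀ g, QH.hGradSq n G g ≤ M') :
    MeasureTheory.Integrable (fun g : QH n => QH.hGradSq n (fun g' => G g' * Φ g') g) ∧
    MeasureTheory.Integrable (fun g : QH n => Φ g ^ 2 * QH.hGradSq n G g) ∧
    MeasureTheory.Integrable (fun g : QH n => K * G g ^ 2 * Φ g ^ p) ∧
    ((∫ g : QH n, QH.hGradSq n (fun g' => G g' * Φ g') g)
      = ∫ g : QH n, (Φ g ^ 2 * QH.hGradSq n G g + K * G g ^ 2 * Φ g ^ p)) := by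
  obtain ⟨M, hM⟩ := hGbd
  obtain ⟨M', hM'⟩ := hGgradbd
  have hG1 : ContDiff ℝ 1 G := hG.of_le (by exact_mod_cast le_top)
  have hD : ∀ g : QH n, 0 < QH.gauge n g := fun g => by linarith [QH.one_le_gauge n g]
  set c : ℝ := 8 ^ (n + 1) with hc
  have hΦ' : ∀ g, Φ g = c * (QH.gauge n g)⁻¹ ^ (n + 1) := fun g => by
    rw [hΦ, inv_pow]; rfl
  have hΦfun : Φ = fun g => c * (QH.gauge n g)⁻¹ ^ (n + 1) := funext hΦ'
  have hKn : K = 2 * n * (n + 1) := by rw [hK, hQ]; ring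
  have hp' : p = ((2 * n + 3 : ℕ) : ℝ) / ((n + 1 : ℕ) : ℝ) := by
    rw [hp, hQ]
    push_cast
    rw [div_eq_div_iff (by nlinarith [(n.cast_nonneg : (0 : ℝ) ≤ n)]) (by positivity)]
    ring
  have hΦp : ∀ g, Φ g ^ p = (8 * (QH.gauge n g)⁻¹) ^ (2 * n + 3) := fun g => by
    have h0 : 0 ≤ 8 * (QH.gauge n g)⁻¹ := by have := hD g; positivity
    rw [hΦ', hc, ← mul_pow, ← Real.rpow_natCast, ← Real.rpow_mul h0, hp',
      mul_div_cancel₀ _ (by positivity), Real.rpow_natCast]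
  have hΦ1 : ContDiff ℝ 1 Φ := by
    rw [hΦfun]
    exact contDiff_const.mul (QH.contDiff_inv_gauge_pow n (n + 1))
  have hΦ2 : Integrable fun g => Φ g ^ 2 := by
    refine ((QH.integrable_inv_gauge_pow n hn).const_mul (c ^ 2)).congr (.of_forall fun g => ?_)
    simp only [hΦ']
    ring
  have hgrad : ∀ (u : QH n → ℝ) g, QH.hGradSq n u g
      = ∑ α, ((fderiv ℝ u g (Pi.single α (1, 0, 0, 0), QH.vertPart n α (1, 0, 0, 0) g.1)) ^ 2
        + (fderiv ℝ u g (Pi.single α (0, 1, 0, 0), QH.vertPart n α (0, 1, 0, 0) g.1)) ^ 2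
        + (fderiv ℝ u g (Pi.single α (0, 0, 1, 0), QH.vertPart n α (0, 0, 1, 0) g.1)) ^ 2
        + (fderiv ℝ u g (Pi.single α (0, 0, 0, 1), QH.vertPart n α (0, 0, 0, 1) g.1)) ^ 2) := by
    intro u g
    simp only [QH.hGradSq, QH.TD, QH.XD, QH.YD, QH.ZD, QH.Tvec_eq, QH.Xvec_eq, QH.Yvec_eq,
      QH.Zvec_eq]
  have hgrad0 : ∀ g, 0 ≤ QH.hGradSq n G g := fun g =>
    Finset.sum_nonneg fun _ _ => by positivity
  have hI2 : Integrable fun g : QH n => Φ g ^ 2 * QH.hGradSq n G g := by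
    refine (hΦ2.const_mul M').mono'
      ((hΦ1.continuous.pow 2).mul (QH.continuous_hGradSq n hG1)).aestronglyMeasurable
      (.of_forall fun g => ?_)
    rw [Real.norm_of_nonneg (mul_nonneg (sq_nonneg _) (hgrad0 g)), mul_comm]
    exact mul_le_mul_of_nonneg_right (hM' g) (sq_nonneg _)
  have hK0 : 0 ≤ K := by rw [hKn]; positivity
  have hI3 : Integrable fun g : QH n => K * G g ^ 2 * Φ g ^ p := by
    simp_rw [hΦp]
    refine ((QH.integrable_inv_gauge_pow n hn).const_mul (K * M ^ 2 * 8 ^ (2 * n + 3))).mono'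
      (((continuous_const.mul (hG1.continuous.pow 2)).mul ((continuous_const.mul
        ((QH.contDiff_gauge n).continuous.inv₀ fun g => (hD g).ne')).pow _)).aestronglyMeasurable)
      (.of_forall fun g => ?_)
    have hDg := hD g
    rw [Real.norm_of_nonneg (by positivity), mul_pow, ← mul_assoc]
    have hGM : G g ^ 2 ≤ M ^ 2 := by
      rw [← sq_abs]
      exact pow_le_pow_left₀ (abs_nonneg _) (hM g) 2
    have hu : (QH.gauge n g)⁻¹ ^ (2 * n + 3) ≤ (QH.gauge n g)⁻¹ ^ (2 * (n + 1)) :=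
      pow_le_pow_of_le_one (by positivity) (inv_le_one_of_one_le₀ (QH.one_le_gauge n g)) (by omega)
    gcongr
  obtain ⟨E, hE⟩ : ∃ E : Fin n → ℝ × ℝ × ℝ × ℝ → QH n → ℝ, ∀ α v g, E α v g
      = (fderiv ℝ (fun x => G x * Φ x) g (Pi.single α v, QH.vertPart n α v g.1)) ^ 2
        - Φ g ^ 2 * (fderiv ℝ G g (Pi.single α v, QH.vertPart n α v g.1)) ^ 2
        + G g ^ 2 * Φ g * (c * QH.invGaugeDD n α v g) := ⟨_, fun _ _ _ => rfl⟩
  have hdir : ∀ (α : Fin n) (v : ℝ × ℝ × ℝ × ℝ), QH.nSq v = 1 →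
      (∀ g, (fderiv ℝ G g (Pi.single α v, QH.vertPart n α v g.1)) ^ 2 ≤ QH.hGradSq n G g) →
      Integrable (E α v) ∧ ∫ g, E α v g = 0 := by
    intro α v hv hle
    rw [show E α v = _ from funext (hE α v), hΦfun]
    exact QH.integral_energy_defect n hn α v hv c G hG1 M (√M') hM
      fun g => Real.abs_le_sqrt ((hle g).trans (hM' g))
  have hterm : ∀ (α : Fin n) g,
      QH.TD n α G g ^ 2 + QH.XD n α G g ^ 2 + QH.YD n α G g ^ 2 + QH.ZD n α G g ^ 2
        ≤ QH.hGradSq n G g := fun α g =>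
    Finset.single_le_sum (f := fun β =>
      QH.TD n β G g ^ 2 + QH.XD n β G g ^ 2 + QH.YD n β G g ^ 2 + QH.ZD n β G g ^ 2)
      (fun _ _ => by positivity) (Finset.mem_univ α)
  simp only [QH.TD, QH.XD, QH.YD, QH.ZD, QH.Tvec_eq, QH.Xvec_eq, QH.Yvec_eq,
    QH.Zvec_eq] at hterm
  have hnn : ∀ (α : Fin n) v g,
      0 ≤ (fderiv ℝ G g (Pi.single α v, QH.vertPart n α v g.1)) ^ 2 := fun _ _ _ => sq_nonneg _
  have hT := fun α => hdir α (1, 0, 0, 0) (by simp [QH.nSq, QH.tC, QH.xC, QH.yC, QH.zC]) fun g => by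
    linarith [hterm α g, hnn α (0, 1, 0, 0) g, hnn α (0, 0, 1, 0) g, hnn α (0, 0, 0, 1) g]
  have hX := fun α => hdir α (0, 1, 0, 0) (by simp [QH.nSq, QH.tC, QH.xC, QH.yC, QH.zC]) fun g => by
    linarith [hterm α g, hnn α (1, 0, 0, 0) g, hnn α (0, 0, 1, 0) g, hnn α (0, 0, 0, 1) g]
  have hY := fun α => hdir α (0, 0, 1, 0) (by simp [QH.nSq, QH.tC, QH.xC, QH.yC, QH.zC]) fun g => by
    linarith [hterm α g, hnn α (1, 0, 0, 0) g, hnn α (0, 1, 0, 0) g, hnn α (0, 0, 0, 1) g]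
  have hZ := fun α => hdir α (0, 0, 0, 1) (by simp [QH.nSq, QH.tC, QH.xC, QH.yC, QH.zC]) fun g => by
    linarith [hterm α g, hnn α (1, 0, 0, 0) g, hnn α (0, 1, 0, 0) g, hnn α (0, 0, 1, 0) g]
  have hdiv : ∀ α, Integrable (fun g => E α (1, 0, 0, 0) g + E α (0, 1, 0, 0) g
        + E α (0, 0, 1, 0) g + E α (0, 0, 0, 1) g) ∧
      ∫ g, (E α (1, 0, 0, 0) g + E α (0, 1, 0, 0) g
        + E α (0, 0, 1, 0) g + E α (0, 0, 0, 1) g) = 0 := fun α => by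
    have h2 := (hT α).1.add (hX α).1
    have h3 := h2.add (hY α).1
    refine ⟨h3.add (hZ α).1, ?_⟩
    rw [integral_add (by exact h3) (hZ α).1, integral_add (by exact h2) (hY α).1,
      integral_add (hT α).1 (hX α).1, (hT α).2, (hX α).2, (hY α).2, (hZ α).2]
    simp
  have hYam : ∀ g, K * G g ^ 2 * Φ g ^ p
      = -(G g ^ 2 * Φ g * c * ∑ α, (QH.invGaugeDD n α (1, 0, 0, 0) g
        + QH.invGaugeDD n α (0, 1, 0, 0) g + QH.invGaugeDD n α (0, 0, 1, 0) g
        + QH.invGaugeDD n α (0, 0, 0, 1) g)) := fun g => by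
    rw [QH.sum_invGaugeDD, hΦp, hΦ', hKn, hc]
    ring
  have hpt : ∀ g, ∑ α, (E α (1, 0, 0, 0) g + E α (0, 1, 0, 0) g
        + E α (0, 0, 1, 0) g + E α (0, 0, 0, 1) g)
      = QH.hGradSq n (fun g' => G g' * Φ g') g
        - (Φ g ^ 2 * QH.hGradSq n G g + K * G g ^ 2 * Φ g ^ p) := fun g => by
    rw [hYam, ← sub_sub, sub_neg_eq_add, hgrad, hgrad, Finset.mul_sum, Finset.mul_sum,
      ← Finset.sum_sub_distrib, ← Finset.sum_add_distrib]
    refine Finset.sum_congr rfl fun α _ => ?_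
    simp only [hE]
    ring
  have hR := hI2.add hI3
  have hdiff := integrable_finsetSum Finset.univ fun (α : Fin n) _ => (hdiv α).1
  have hzero := integral_finsetSum Finset.univ fun (α : Fin n) _ => (hdiv α).1
  simp only [hpt, (hdiv _).2, Finset.sum_const_zero] at hdiff hzero
  have hI1 : Integrable fun g : QH n => QH.hGradSq n (fun g' => G g' * Φ g') g :=
    (hdiff.add hR).congr (.of_forall fun _ => sub_add_cancel _ _)
  refine ⟨hI1, hI2, hI3, ?_⟩
  rw [integral_sub hI1 (by exact hR)] at hzero
  exact sub_eq_zero.1 hzero
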